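/- arXiv:2506.03393 — 5 statements merged into one kernel-verified Lean document; each statement's English description precedes it below -/
import Mathlib

section
/- Let V be an N×N real positive definite matrix, Z an M×M real positive definite matrix, X an N×p real matrix such that XᵀV⁻¹X is positive definite, B an M×p real matrix, and E an M×q real matrix such that EᵀZ⁻¹E is positive definite. Then the matrix S = XᵀV⁻¹X + BᵀZ⁻¹B − BᵀZ⁻¹E(EᵀZ⁻¹E)⁻¹EᵀZ⁻¹B is positive definite and S⁻¹ ⪯ (XᵀV⁻¹X)⁻¹ in the Loewner order, i.e., (XᵀV⁻¹X)⁻¹ − S⁻¹ is positive semidefinite. (This is the matrix core of Theorem 2.1: the asymptotic variance of the treatment-effect estimator from the quadratic estimating equations of the structural equation model is no larger than that of the saturated-model estimator.) -/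
open Matrix

namespace Matrix

/-- Inversion is antitone on positive definite matrices for the Loewner order. -/
theorem PosDef.posSemidef_inv_sub_inv {n : Type*} [Fintype n] [DecidableEq n]
    {P Q : Matrix n n ℝ} (hP : P.PosDef) (hQ : Q.PosDef) (h : (Q - P).PosSemidef) :
    (P⁻¹ - Q⁻¹).PosSemidef := by
  let := hP.isUnit.invertible
  let := hQ.isUnit.invertible
  let := hP.inv.isUnit.invertible
  have hblock := (PosDef.fromBlocks₂₂ Q (1 : Matrix n n ℝ) hP.inv).2 (by simpa using h)
  simpa using (PosDef.fromBlocks₁₁ (1 : Matrix n n ℝ) P⁻¹ hQ).1 hblock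

/-- The generalized least squares residual form `W - W E (Eᵀ W E)⁻¹ Eᵀ W` is positive
semidefinite. -/
theorem PosSemidef.sub_mul_inv_mul {m n : Type*} [Fintype m] [Fintype n] [DecidableEq m]
    [DecidableEq n] {W : Matrix m m ℝ} (hW : W.PosSemidef) {E : Matrix m n ℝ}
    (hE : (Eᵀ * W * E).PosDef) :
    (W - W * E * (Eᵀ * W * E)⁻¹ * Eᵀ * W).PosSemidef := by
  let := hE.isUnit.invertible
  have hWt : Wᵀ = W := by simpa using hW.isHermitian.eq
  have hblock : (fromBlocks (Eᵀ * W * E) (Eᵀ * W) (Eᵀ * W)ᴴ W).PosSemidef := by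
    have h := hW.conjTranspose_mul_mul_same (fromCols E (1 : Matrix m m ℝ))
    rw [conjTranspose_fromCols_eq_fromRows_conjTranspose, fromRows_mul,
      fromRows_mul_fromCols] at h
    simpa [hWt] using h
  simpa [hWt, Matrix.mul_assoc] using (PosDef.fromBlocks₁₁ (Eᵀ * W) W hE).1 hblock

end Matrix

/-- Matrix core of Theorem 2.1: the asymptotic variance of the SEM (quadratic
estimating equations) estimator is no larger than that of the saturated-model
estimator, in the Loewner order. -/
theorem stmt_0 {N M p q : ℕ}
    (V : Matrix (Fin N) (Fin N) ℝ) (hV : V.PosDef)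
    (Z : Matrix (Fin M) (Fin M) ℝ) (hZ : Z.PosDef)
    (X : Matrix (Fin N) (Fin p) ℝ) (hX : (Xᵀ * V⁻¹ * X).PosDef)
    (B : Matrix (Fin M) (Fin p) ℝ)
    (E : Matrix (Fin M) (Fin q) ℝ) (hE : (Eᵀ * Z⁻¹ * E).PosDef) :
    (Xᵀ * V⁻¹ * X + Bᵀ * Z⁻¹ * B
        - Bᵀ * Z⁻¹ * E * (Eᵀ * Z⁻¹ * E)⁻¹ * Eᵀ * Z⁻¹ * B).PosDef ∧
      ((Xᵀ * V⁻¹ * X)⁻¹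
        - (Xᵀ * V⁻¹ * X + Bᵀ * Z⁻¹ * B
            - Bᵀ * Z⁻¹ * E * (Eᵀ * Z⁻¹ * E)⁻¹ * Eᵀ * Z⁻¹ * B)⁻¹).PosSemidef := by
  have hK := (hZ.inv.posSemidef.sub_mul_inv_mul hE).conjTranspose_mul_mul_same B
  have hS : Bᵀ * Z⁻¹ * B - Bᵀ * Z⁻¹ * E * (Eᵀ * Z⁻¹ * E)⁻¹ * Eᵀ * Z⁻¹ * B =
      Bᴴ * (Z⁻¹ - Z⁻¹ * E * (Eᵀ * Z⁻¹ * E)⁻¹ * Eᵀ * Z⁻¹) * B := by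
    simp [Matrix.mul_sub, Matrix.sub_mul, Matrix.mul_assoc]
  rw [add_sub_assoc, hS]
  have hpos := hX.add_posSemidef hK
  exact ⟨hpos, hX.posSemidef_inv_sub_inv hpos (by simpa using hK)⟩
end

section
/- Let (Ω, 𝓕, ℙ) be a probability space and let η and ε be independent real-valued random variables with law(η) = gaussianReal(γ·a, 1) and law(ε) = gaussianReal(0, 1), where γ, a, ν₁, λ₁ ∈ ℝ. Then ℙ(ν₁ + λ₁·η + ε > 0) = Φ((ν₁ + γ·λ₁·a)/√(1 + λ₁²)), where Φ is the standard Gaussian cumulative distribution function. (This is the marginal Bernoulli success probability of a binary endpoint under the probit structural equation model.) -/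
open MeasureTheory ProbabilityTheory

/-- The probability that a nondegenerate Gaussian variable is positive, through the standard
Gaussian distribution function. -/
theorem measure_pos_of_hasLaw_gaussianReal {Ω : Type*} {mΩ : MeasurableSpace Ω} {P : Measure Ω}
    {W : Ω → ℝ} {m s : ℝ} {v : NNReal} (hW : HasLaw W (gaussianReal m v) P)
    (hs : 0 < s) (hv : (v : ℝ) = s ^ 2) :
    P {ω | 0 < W ω} = gaussianReal 0 1 (Set.Iic (m / s)) := by
  have hT : HasLaw (fun ω ↦ (m - W ω) / s) (gaussianReal 0 1) P := by
    convert gaussianReal_div_const (gaussianReal_const_sub hW m) s using 2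
    · simp
    · ext
      simp [hv, hs.ne']
  have := nullSingletonClass_gaussianReal (μ := 0) (v := 1) one_ne_zero
  rw [← measure_congr (Iio_ae_eq_Iic (μ := gaussianReal 0 1)), ← hT.map_eq,
    Measure.map_apply_of_aemeasurable hT.aemeasurable measurableSet_Iio]
  congr 1
  ext ω
  simp [div_lt_div_iff_of_pos_right hs]

/-- Marginal Bernoulli success probability of a binary endpoint under the
probit structural equation model:
`ℙ(ν₁ + λ₁ η + ε > 0) = Φ((ν₁ + γ λ₁ a) / √(1 + λ₁²))`. -/
theorem stmt_8 {Ω : Type*} [MeasureSpace Ω] [IsProbabilityMeasure (ℙ : Measure Ω)]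
    (η ε : Ω → ℝ) (hη : Measurable η) (hε : Measurable ε)
    (hind : IndepFun η ε ℙ)
    (γ a ν₁ lam₁ : ℝ)
    (hlawη : Measure.map η ℙ = gaussianReal (γ * a) 1)
    (hlawε : Measure.map ε ℙ = gaussianReal 0 1) :
    (ℙ {ω | 0 < ν₁ + lam₁ * η ω + ε ω}).toReal =
      (gaussianReal 0 1
        (Set.Iic ((ν₁ + γ * lam₁ * a) / Real.sqrt (1 + lam₁ ^ 2)))).toReal := by
  have hη' : HasLaw η (gaussianReal (γ * a) 1) ℙ := ⟨hη.aemeasurable, hlawη⟩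
  have hmul := gaussianReal_const_mul hη' lam₁
  have hind' : IndepFun (fun ω ↦ lam₁ * η ω) ε ℙ :=
    hind.comp (measurable_const_mul lam₁) measurable_id
  have hadd : HasLaw ((fun ω ↦ lam₁ * η ω) + ε) _ ℙ :=
    ⟨by fun_prop, gaussianReal_add_gaussianReal_of_indepFun hind' hmul.map_eq hlawε⟩
  have hpos : 0 < 1 + lam₁ ^ 2 := by positivity
  have h := measure_pos_of_hasLaw_gaussianReal (gaussianReal_const_add hadd ν₁)
    (Real.sqrt_pos.2 hpos) (by rw [Real.sq_sqrt hpos.le]; simp [add_comm])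
  have hmean : lam₁ * (γ * a) + 0 + ν₁ = ν₁ + γ * lam₁ * a := by ring
  rw [hmean] at h
  simp only [Pi.add_apply, ← add_assoc] at h
  rw [h]
end

section
/- Let (Ω, 𝓕, ℙ) be a probability space. For a ∈ {0, 1}, let η⁽ᵃ⁾ and ε⁽ᵃ⁾ be independent real-valued random variables with law(η⁽ᵃ⁾) = gaussianReal(γ·a, 1) and law(ε⁽ᵃ⁾) = gaussianReal(0, 1), where γ, ν₁, λ₁ ∈ ℝ. Then the average treatment effect on the binary endpoint 1{ν₁ + λ₁·η⁽ᵃ⁾ + ε⁽ᵃ⁾ > 0} satisfies ℙ(ν₁ + λ₁·η⁽¹⁾ + ε⁽¹⁾ > 0) − ℙ(ν₁ + λ₁·η⁽⁰⁾ + ε⁽⁰⁾ > 0) = Φ((ν₁ + γ·λ₁)/√(1 + λ₁²)) − Φ(ν₁/√(1 + λ₁²)). -/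
open MeasureTheory ProbabilityTheory

lemma ProbabilityTheory.HasLaw.measure_pos_gaussianReal {Ω : Type*} {mΩ : MeasurableSpace Ω}
    {P : Measure Ω} {X : Ω → ℝ} {m : ℝ} {v : NNReal} (hX : HasLaw X (gaussianReal m v) P)
    (hv : v ≠ 0) :
    P {ω | 0 < X ω} = gaussianReal 0 1 (Set.Iic (m / Real.sqrt v)) := by
  have hs : 0 < Real.sqrt v := Real.sqrt_pos.2 (by positivity)
  have hZ : HasLaw (fun ω ↦ (m - X ω) / Real.sqrt v) (gaussianReal 0 1) P := by
    convert gaussianReal_div_const (gaussianReal_const_sub hX m) (Real.sqrt v) using 2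
    · simp
    · ext
      simp [hv]
  have := nullSingletonClass_gaussianReal (μ := 0) (one_ne_zero : (1 : NNReal) ≠ 0)
  rw [← measure_congr Iio_ae_eq_Iic, ← hZ.map_eq,
    Measure.map_apply_of_aemeasurable hZ.aemeasurable measurableSet_Iio]
  congr 1
  ext ω
  simp [div_lt_div_iff_of_pos_right hs]

lemma ProbabilityTheory.IndepFun.measure_probit_pos {Ω : Type*} {mΩ : MeasurableSpace Ω}
    {P : Measure Ω} {X Y : Ω → ℝ} {m : ℝ} (hXY : IndepFun X Y P)
    (hX : HasLaw X (gaussianReal m 1) P) (hY : HasLaw Y (gaussianReal 0 1) P) (a b : ℝ) :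
    P {ω | 0 < a + b * X ω + Y ω} =
      gaussianReal 0 1 (Set.Iic ((a + m * b) / Real.sqrt (1 + b ^ 2))) := by
  have hL := gaussianReal_const_add (gaussianReal_const_mul hX b) a
  have hind : IndepFun (fun ω ↦ a + b * X ω) Y P :=
    hXY.comp (φ := fun x ↦ a + b * x) (ψ := id) (by fun_prop) measurable_id
  have hsum : HasLaw (fun ω ↦ a + b * X ω + Y ω)
      (gaussianReal (a + m * b) (.mk (1 + b ^ 2) (by positivity))) P := by
    refine ⟨hL.aemeasurable.add hY.aemeasurable, ?_⟩
    refine (gaussianReal_add_gaussianReal_of_indepFun hind hL.map_eq hY.map_eq).trans ?_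
    rw [gaussianReal_ext_iff]
    constructor
    · ring
    · ext
      simp [add_comm]
  refine hsum.measure_pos_gaussianReal fun h ↦ ?_
  have : 1 + b ^ 2 = 0 := congrArg NNReal.toReal h
  nlinarith [sq_nonneg b]

/-- Average treatment effect on a binary endpoint under the probit structural
equation model:
`ℙ(ν₁ + λ₁ η⁽¹⁾ + ε⁽¹⁾ > 0) − ℙ(ν₁ + λ₁ η⁽⁰⁾ + ε⁽⁰⁾ > 0)
  = Φ((ν₁ + γ λ₁)/√(1 + λ₁²)) − Φ(ν₁/√(1 + λ₁²))`. -/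
theorem stmt_9 {Ω : Type*} [MeasureSpace Ω] [IsProbabilityMeasure (ℙ : Measure Ω)]
    (η ε : Fin 2 → Ω → ℝ) (hη : ∀ a, Measurable (η a)) (hε : ∀ a, Measurable (ε a))
    (hind : ∀ a, IndepFun (η a) (ε a) ℙ)
    (γ ν₁ lam₁ : ℝ)
    (hlawη : ∀ a : Fin 2, Measure.map (η a) ℙ = gaussianReal (γ * ((a : ℕ) : ℝ)) 1)
    (hlawε : ∀ a : Fin 2, Measure.map (ε a) ℙ = gaussianReal 0 1) :
    (ℙ {ω | 0 < ν₁ + lam₁ * η 1 ω + ε 1 ω}).toReal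
        - (ℙ {ω | 0 < ν₁ + lam₁ * η 0 ω + ε 0 ω}).toReal =
      (gaussianReal 0 1
          (Set.Iic ((ν₁ + γ * lam₁) / Real.sqrt (1 + lam₁ ^ 2)))).toReal
        - (gaussianReal 0 1
          (Set.Iic (ν₁ / Real.sqrt (1 + lam₁ ^ 2)))).toReal := by
  have key (a : Fin 2) := (hind a).measure_probit_pos
    ⟨(hη a).aemeasurable, hlawη a⟩ ⟨(hε a).aemeasurable, hlawε a⟩ ν₁ lam₁
  rw [key 1, key 0]
  simp
end

section
/- Let (Ω, 𝓕, ℙ) be a probability space, (Xₙ)ₙ a sequence of real-valued random variables whose laws converge weakly to some probability measure μ on ℝ, and let c < 0 be a constant. Then the BIC model-averaging weights ω̂ₙ = (exp{(Xₙ + c·log n)/2} + 1)⁻¹ converge to 1 in probability as n → ∞. (This is the null case of Theorem 2.2: when the structural equation model is correctly specified, the likelihood-ratio statistic converges in distribution, the log-BIC difference tends to −∞, and all model-averaging weight is asymptotically placed on the structural equation model.) -/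
open MeasureTheory ProbabilityTheory Filter

/-- If the laws of `Xₙ` converge weakly to a probability measure, then the upper tails of `Xₙ`
beyond any deterministic sequence tending to infinity have vanishing probability. -/
theorem tendsto_measure_le_of_tendsto_integral_map {Ω : Type*} [MeasurableSpace Ω]
    {P : Measure Ω} [IsProbabilityMeasure P] {X : ℕ → Ω → ℝ} (hX : ∀ n, Measurable (X n))
    {μ : Measure ℝ} [IsProbabilityMeasure μ]
    (hweak : ∀ f : BoundedContinuousFunction ℝ ℝ,
      Tendsto (fun n => ∫ x, f x ∂(Measure.map (X n) P)) atTop (nhds (∫ x, f x ∂μ)))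
    {a : ℕ → ℝ} (ha : Tendsto a atTop atTop) :
    Tendsto (fun n => P {ω | a n ≤ X n ω}) atTop (nhds 0) := by
  let ν : ℕ → ProbabilityMeasure ℝ := fun n =>
    ⟨Measure.map (X n) P, Measure.isProbabilityMeasure_map (hX n).aemeasurable⟩
  have hν : Tendsto ν atTop (nhds ⟨μ, inferInstance⟩) :=
    ProbabilityMeasure.tendsto_iff_forall_integral_tendsto.2 hweak
  have htail : Tendsto (fun M : ℝ => μ (Set.Ici M)) atTop (nhds 0) := by
    have h := tendsto_measure_iInter_atTop (μ := μ) (s := fun M : ℝ => Set.Ici M)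
      (fun M => measurableSet_Ici.nullMeasurableSet)
      (fun _ _ hab => Set.Ici_subset_Ici.2 hab) ⟨0, measure_ne_top _ _⟩
    have hempty : ⋂ M : ℝ, Set.Ici M = ∅ :=
      Set.eq_empty_of_forall_notMem fun x hx => by
        have := Set.mem_iInter.1 hx (x + 1)
        simp only [Set.mem_Ici] at this
        linarith
    rwa [hempty, measure_empty] at h
  rw [ENNReal.tendsto_nhds_zero]
  intro ε hε
  obtain ⟨M, hM⟩ := (htail.eventually_lt_const hε).exists
  have hlimsup := ProbabilityMeasure.limsup_measure_closed_le_of_tendsto hν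
    (isClosed_Ici (a := M))
  filter_upwards [eventually_lt_of_limsup_lt (hlimsup.trans_lt hM), ha.eventually_ge_atTop M]
    with n hn hMn
  have hmap : (ν n : Measure ℝ) (Set.Ici M) = P (X n ⁻¹' Set.Ici M) :=
    Measure.map_apply (hX n) measurableSet_Ici
  rw [hmap] at hn
  exact (measure_mono fun ω hω => hMn.trans hω).trans hn.le

/-- The inverse `(exp t + 1)⁻¹` differs from `1` by at most `exp t`. -/
theorem abs_inv_exp_add_one_sub_one_le (t : ℝ) :
    |(Real.exp t + 1)⁻¹ - 1| ≤ Real.exp t := by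
  have h := Real.exp_pos t
  have heq : (Real.exp t + 1)⁻¹ - 1 = -(Real.exp t / (Real.exp t + 1)) := by
    field_simp
    ring
  rw [heq, abs_neg, abs_of_pos (by positivity)]
  exact div_le_self h.le (by linarith)

/-- Null case of Theorem 2.2: if the likelihood-ratio statistics `Xₙ` converge
in distribution to some limit and `c < 0`, then the BIC model-averaging
weights `ω̂ₙ = (exp{(Xₙ + c log n)/2} + 1)⁻¹` converge to `1` in probability;
all weight is asymptotically placed on the structural equation model. -/
theorem stmt_13 {Ω : Type*} [MeasureSpace Ω] [IsProbabilityMeasure (ℙ : Measure Ω)]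
    (X : ℕ → Ω → ℝ) (hX : ∀ n, Measurable (X n))
    (μ : Measure ℝ) [IsProbabilityMeasure μ]
    (hweak : ∀ f : BoundedContinuousFunction ℝ ℝ,
      Tendsto (fun n => ∫ x, f x ∂(Measure.map (X n) ℙ)) atTop
        (nhds (∫ x, f x ∂μ)))
    (c : ℝ) (hc : c < 0) :
    ∀ δ > (0 : ℝ),
      Tendsto
        (fun n => ℙ {ω |
          δ ≤ |(Real.exp ((X n ω + c * Real.log n) / 2) + 1)⁻¹ - 1|})
        atTop (nhds 0) := by
  intro δ hδ
  have hlog : Tendsto (fun n : ℕ => Real.log n) atTop atTop :=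
    Real.tendsto_log_atTop.comp tendsto_natCast_atTop_atTop
  have ha : Tendsto (fun n : ℕ => 2 * Real.log δ + -c * Real.log n) atTop atTop :=
    tendsto_atTop_add_const_left _ _ (hlog.const_mul_atTop (neg_pos.2 hc))
  refine tendsto_of_tendsto_of_tendsto_of_le_of_le tendsto_const_nhds
    (tendsto_measure_le_of_tendsto_integral_map hX hweak ha) (fun _ => zero_le) fun n =>
      measure_mono fun ω hω => ?_
  have h := (Real.log_le_iff_le_exp hδ).2
    (le_trans (Set.mem_ofPred_eq ▸ hω) (abs_inv_exp_add_one_sub_one_le _))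
  simp only [Set.mem_ofPred_eq]
  linarith
end

section
/- Let (Ω, 𝓕, ℙ) be a probability space, (Xₙ)ₙ a sequence of real-valued random variables such that Xₙ/n converges in probability to a constant δ > 0, and let c ∈ ℝ be any constant. Then the BIC model-averaging weights ω̂ₙ = (exp{(Xₙ + c·log n)/2} + 1)⁻¹ converge to 0 in probability as n → ∞. (This is the misspecified case of Theorem 2.2: when the structural equation model is misspecified, the likelihood-ratio statistic grows linearly in n, dominating the log(n) BIC penalty, so all model-averaging weight is asymptotically placed on the saturated model.) -/
open MeasureTheory ProbabilityTheory Filter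

/-- A positive linear term dominates any multiple of the logarithm. -/
theorem tendsto_linear_add_const_mul_log_atTop {a : ℝ} (ha : 0 < a) (c : ℝ) :
    Tendsto (fun x : ℝ => a * x + c * Real.log x) atTop atTop := by
  refine tendsto_atTop_mono' _ ?_ (tendsto_id.const_mul_atTop (half_pos ha))
  filter_upwards [(Real.isLittleO_log_id_atTop.const_mul_left c).bound (half_pos ha),
    eventually_ge_atTop 0] with x hx hx0
  simp only [id, Real.norm_eq_abs, abs_of_nonneg hx0] at hx ⊢
  linarith [neg_le_of_abs_le hx]

/-- Misspecified case of Theorem 2.2: if the likelihood-ratio statistics `Xₙ`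
satisfy `Xₙ/n →ᵖ δ > 0`, then for any constant `c` the BIC model-averaging
weights `ω̂ₙ = (exp{(Xₙ + c log n)/2} + 1)⁻¹` converge to `0` in probability;
all weight is asymptotically placed on the saturated model. -/
theorem stmt_14 {Ω : Type*} [MeasureSpace Ω] [IsProbabilityMeasure (ℙ : Measure Ω)]
    (X : ℕ → Ω → ℝ) (hX : ∀ n, Measurable (X n))
    (δ : ℝ) (hδ : 0 < δ)
    (hprob : ∀ ε > (0 : ℝ),
      Tendsto (fun n => ℙ {ω | ε ≤ |X n ω / n - δ|}) atTop (nhds 0))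
    (c : ℝ) :
    ∀ ε > (0 : ℝ),
      Tendsto
        (fun n => ℙ {ω |
          ε ≤ |(Real.exp ((X n ω + c * Real.log n) / 2) + 1)⁻¹ - 0|})
        atTop (nhds 0) := by
  intro ε hε
  have hlim : Tendsto
      (fun n : ℕ => (Real.exp ((δ / 2 * n + c * Real.log n) / 2) + 1)⁻¹) atTop (nhds 0) :=
    (tendsto_atTop_add_const_right _ 1 (Real.tendsto_exp_atTop.comp
      (((tendsto_linear_add_const_mul_log_atTop (half_pos hδ) c).comp
        tendsto_natCast_atTop_atTop).atTop_div_const two_pos))).inv_tendsto_atTop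
  refine tendsto_of_tendsto_of_tendsto_of_le_of_le' tendsto_const_nhds
    (hprob (δ / 2) (half_pos hδ)) (Eventually.of_forall fun _ => zero_le) ?_
  filter_upwards [hlim.eventually_lt_const hε, eventually_gt_atTop 0] with n hn hn0
  refine measure_mono fun ω hω => ?_
  simp only [Set.mem_ofPred_eq, sub_zero] at hω ⊢
  rw [abs_of_pos (by positivity)] at hω
  by_contra! hclose
  have hnpos : (0 : ℝ) < n := Nat.cast_pos.mpr hn0
  have hXn : δ / 2 * n ≤ X n ω := by
    rw [← le_div_iff₀ hnpos]
    linarith [(abs_lt.mp hclose).1]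
  have hle : (Real.exp ((X n ω + c * Real.log n) / 2) + 1)⁻¹ ≤
      (Real.exp ((δ / 2 * n + c * Real.log n) / 2) + 1)⁻¹ := by
    gcongr
  linarith
end
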